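/- arXiv:2107.05353 — 2 statements merged into one kernel-verified Lean document; each statement's English description precedes it below -/
import Mathlib

section
/- Let P₁, P₂ ⊆ ℝ² be compact convex lattice polygons, i.e. convex hulls of nonempty finite subsets of ℤ². Then the number of lattice points satisfies |(P₁+P₂) ∩ ℤ²| = |P₁ ∩ ℤ²| + |P₂ ∩ ℤ²| + (vol(P₁+P₂) − vol(P₁) − vol(P₂)) − 1, where vol is Lebesgue measure and P₁+P₂ is the Minkowski sum. -/
open Pointwise MeasureTheory

/-- The number of lattice points of a set `P ⊆ ℝ²`. -/
noncomputable def latticeCount (P : Set (Fin 2 → ℝ)) : ℕ :=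
  Set.ncard {a : Fin 2 → ℤ | (fun i => (a i : ℝ)) ∈ P}

open Filter Topology

/-! ### Convexity -/

section Convexity

variable {E : Type*} [AddCommGroup E] [Module ℝ E]

/-- A segment whose end points lie on the two sides of a level of a linear functional meets
that level. -/
theorem exists_mem_segment_map_eq (l : E →ₗ[ℝ] ℝ) {c : ℝ} {x y : E} (hx : c ≤ l x)
    (hy : l y ≤ c) : ∃ z ∈ segment ℝ x y, l z = c := by
  have h : c ∈ segment ℝ (l y) (l x) := by
    rw [segment_eq_Icc (hy.trans hx)]; exact ⟨hy, hx⟩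
  rw [segment_symm] at h
  have := image_segment ℝ l.toAffineMap x y
  simp only [LinearMap.coe_toAffineMap] at this
  rw [← this] at h
  exact h

theorem le_map_of_mem_convexHull (l : E →ₗ[ℝ] ℝ) {c : ℝ} {s : Set E} (hs : ∀ v ∈ s, c ≤ l v)
    {x : E} (hx : x ∈ convexHull ℝ s) : c ≤ l x :=
  convexHull_min (t := {y | c ≤ l y}) hs (convex_halfSpace_ge l.isLinear c) hx

theorem map_le_of_mem_convexHull (l : E →ₗ[ℝ] ℝ) {c : ℝ} {s : Set E} (hs : ∀ v ∈ s, l v ≤ c)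
    {x : E} (hx : x ∈ convexHull ℝ s) : l x ≤ c :=
  convexHull_min (t := {y | l y ≤ c}) hs (convex_halfSpace_le l.isLinear c) hx

/-- Cutting a convex hull along a hyperplane which meets it in a segment. -/
theorem convexHull_inter_eq_segment (l : E →ₗ[ℝ] ℝ) (c : ℝ) {A B : Set E} {a b : E}
    (hA : ∀ v ∈ A, c ≤ l v) (hB : ∀ v ∈ B, l v ≤ c) (haA : a ∈ A) (haB : a ∈ B) (hbA : b ∈ A)
    (hbB : b ∈ B) (h : ∀ x ∈ convexHull ℝ (A ∪ B), l x = c → x ∈ segment ℝ a b) :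
    convexHull ℝ A ∩ convexHull ℝ B = segment ℝ a b := by
  apply Set.Subset.antisymm
  · rintro x ⟨hxA, hxB⟩
    exact h x (convexHull_mono Set.subset_union_left hxA)
      ((map_le_of_mem_convexHull l hB hxB).antisymm (le_map_of_mem_convexHull l hA hxA))
  · exact Set.subset_inter (segment_subset_convexHull haA hbA) (segment_subset_convexHull haB hbB)

theorem convexHull_union_eq_union (l : E →ₗ[ℝ] ℝ) (c : ℝ) {A B : Set E} {a b : E}
    (hA : ∀ v ∈ A, c ≤ l v) (hB : ∀ v ∈ B, l v ≤ c) (haA : a ∈ A) (haB : a ∈ B) (hbA : b ∈ A)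
    (hbB : b ∈ B) (h : ∀ x ∈ convexHull ℝ (A ∪ B), l x = c → x ∈ segment ℝ a b) :
    convexHull ℝ (A ∪ B) = convexHull ℝ A ∪ convexHull ℝ B := by
  apply Set.Subset.antisymm
  · intro x hx
    have hx' := hx
    rw [convexHull_union ⟨a, haA⟩ ⟨a, haB⟩, mem_convexJoin] at hx'
    obtain ⟨p, hp, q, hq, hxpq⟩ := hx'
    have hpA := le_map_of_mem_convexHull l hA hp
    have hqB := map_le_of_mem_convexHull l hB hq
    have hp' := convexHull_mono (𝕜 := ℝ) (Set.subset_union_left (t := B)) hp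
    have hq' := convexHull_mono (𝕜 := ℝ) (Set.subset_union_right (s := A)) hq
    have hcv := convex_convexHull ℝ (A ∪ B)
    rcases le_total c (l x) with hcx | hcx
    · obtain ⟨z, hz, hlz⟩ := exists_mem_segment_map_eq l hcx hqB
      have hzab := h z (hcv.segment_subset hx hq' hz) hlz
      refine Or.inl ((convex_convexHull ℝ A).segment_subset hp
        (segment_subset_convexHull haA hbA hzab) ?_)
      rw [mem_segment_iff_wbtw] at *
      exact (hxpq.symm.trans_left_right hz.symm).symm
    · obtain ⟨z, hz, hlz⟩ := exists_mem_segment_map_eq l hpA hcx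
      have hzab := h z (hcv.segment_subset hp' hx hz) hlz
      refine Or.inr ((convex_convexHull ℝ B).segment_subset
        (segment_subset_convexHull haB hbB hzab) hq ?_)
      rw [mem_segment_iff_wbtw] at *
      exact hxpq.trans_left_right hz
  · exact Set.union_subset (convexHull_mono Set.subset_union_left)
      (convexHull_mono Set.subset_union_right)

/-- If `a` is not in the convex hull of `s`, then a point of the hull of `insert a s` which is on
the line through `a` and `b ∈ s` is on the same side of `a` as `b`. -/
theorem nonneg_of_lineMap_mem_convexHull_insert {s : Set E} {a b : E} (hb : b ∈ s)
    (ha : a ∉ convexHull ℝ s) {t : ℝ}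
    (ht : a + t • (b - a) ∈ convexHull ℝ (insert a s)) : 0 ≤ t := by
  by_contra! h
  rw [convexHull_insert ⟨b, hb⟩, mem_convexJoin] at ht
  obtain ⟨a', ha', r, hr, x, y, hx, hy, hxy, he⟩ := ht
  rw [Set.mem_singleton_iff] at ha'
  rw [ha'] at he
  apply ha
  have hpos : 0 < y - t := by linarith
  have hmem := (convex_convexHull ℝ s) hr (subset_convexHull ℝ s hb)
    (div_nonneg hy hpos.le) (div_nonneg (neg_nonneg.2 h.le) hpos.le)
    (by field_simp; ring)
  have key : (y - t) • a = y • r + (-t) • b := by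
    obtain rfl : x = 1 - y := by linarith
    linear_combination (norm := module) (-1 : ℝ) • he
  rw [div_eq_inv_mul, div_eq_inv_mul, mul_smul, mul_smul, ← smul_add, ← key,
    inv_smul_smul₀ hpos.ne'] at hmem
  exact hmem

/-- Intersections of compact convex sets with convex union commute with Minkowski sums. -/
theorem inter_add_of_convex_union {E : Type*} [AddCommGroup E] [Module ℝ E] [TopologicalSpace E]
    [IsTopologicalAddGroup E] [ContinuousSMul ℝ E] {K L Q : Set E} (hK : IsClosed K)
    (hL : IsClosed L) (hQ : Convex ℝ Q) (hKL : Convex ℝ (K ∪ L)) :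
    K ∩ L + Q = (K + Q) ∩ (L + Q) := by
  apply Set.Subset.antisymm Set.inter_add_subset
  rintro _ ⟨⟨k, hk, q, hq, rfl⟩, ⟨m, hm, r, hr, he⟩⟩
  let g : ℝ → E := fun t => (1 - t) • k + t • m
  have hg : Continuous g := by fun_prop
  have hpre : IsPreconnected (Set.Icc (0 : ℝ) 1) := isPreconnected_Icc
  rw [isPreconnected_closed_iff] at hpre
  obtain ⟨t, ht, htK, htL⟩ := hpre (g ⁻¹' K) (g ⁻¹' L) (hK.preimage hg) (hL.preimage hg)
    (fun t ht => hKL (Or.inl hk) (Or.inr hm) (sub_nonneg.2 ht.2) ht.1 (by ring))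
    ⟨0, by simp, by simpa [g] using hk⟩ ⟨1, by simp, by simpa [g] using hm⟩
  refine ⟨g t, ⟨htK, htL⟩, (1 - t) • q + t • r,
    hQ hq hr (sub_nonneg.2 ht.2) ht.1 (by ring), ?_⟩
  simp only at he
  have : r = k + q - m := by rw [← he]; abel
  simp only [g, this]
  module

end Convexity

/-! ### Lattice polygons -/

/-- The embedding `ℤ² → ℝ²`. -/
def latticeVec : (Fin 2 → ℤ) →+ (Fin 2 → ℝ) where
  toFun a i := a i
  map_zero' := by ext; simp
  map_add' a b := by ext; simp

/-- The convex hull of a set of lattice points. -/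
def latticeHull (V : Set (Fin 2 → ℤ)) : Set (Fin 2 → ℝ) := convexHull ℝ (latticeVec '' V)

/-- Convex hulls of nonempty finite sets of lattice points. -/
def IsLatticePolygon (P : Set (Fin 2 → ℝ)) : Prop :=
  ∃ V : Set (Fin 2 → ℤ), V.Finite ∧ V.Nonempty ∧ latticeHull V = P

theorem latticeVec_injective : Function.Injective latticeVec := by
  intro a b h
  ext i
  have := congrFun h i
  simpa [latticeVec] using this

theorem latticeHull_singleton (a : Fin 2 → ℤ) : latticeHull {a} = {latticeVec a} := by
  simp [latticeHull]

theorem latticeHull_pair (a b : Fin 2 → ℤ) :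
    latticeHull {a, b} = segment ℝ (latticeVec a) (latticeVec b) := by
  simp [latticeHull, Set.image_insert_eq, convexHull_pair]

theorem latticeHull_add (V W : Set (Fin 2 → ℤ)) :
    latticeHull (V + W) = latticeHull V + latticeHull W := by
  rw [latticeHull, Set.image_add, convexHull_add]
  rfl

theorem latticeHull_image_add (V : Set (Fin 2 → ℤ)) (w : Fin 2 → ℤ) :
    latticeHull ((· + w) '' V) = latticeHull V + {latticeVec w} := by
  rw [← Set.add_singleton, latticeHull_add, latticeHull_singleton]

theorem latticeHull_image_nsmul (V : Set (Fin 2 → ℤ)) (k : ℕ) :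
    latticeHull ((k • ·) '' V) = (k : ℝ) • latticeHull V := by
  rw [latticeHull, latticeHull, ← convexHull_smul, Set.image_image, ← Set.image_smul,
    Set.image_image]
  simp only [map_nsmul, Nat.cast_smul_eq_nsmul]

theorem latticeHull_image_add_self (V : Set (Fin 2 → ℤ)) :
    latticeHull ((fun v => v + v) '' V) = (2 : ℝ) • latticeHull V := by
  have := latticeHull_image_nsmul V 2
  simp only [two_nsmul, Nat.cast_ofNat] at this
  exact this

theorem isLatticePolygon_latticeHull {V : Set (Fin 2 → ℤ)} (hV : V.Finite) (hV' : V.Nonempty) :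
    IsLatticePolygon (latticeHull V) :=
  ⟨V, hV, hV', rfl⟩

namespace IsLatticePolygon

variable {P Q : Set (Fin 2 → ℝ)}

theorem add (hP : IsLatticePolygon P) (hQ : IsLatticePolygon Q) : IsLatticePolygon (P + Q) := by
  obtain ⟨V, hV, hV', rfl⟩ := hP
  obtain ⟨W, hW, hW', rfl⟩ := hQ
  exact ⟨V + W, hV.add hW, hV'.add hW', latticeHull_add V W⟩

theorem two_smul (hP : IsLatticePolygon P) : IsLatticePolygon ((2 : ℝ) • P) := by
  obtain ⟨V, hV, hV', rfl⟩ := hP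
  exact ⟨_, hV.image _, hV'.image _, latticeHull_image_add_self V⟩

theorem convex (hP : IsLatticePolygon P) : Convex ℝ P := by
  obtain ⟨V, -, -, rfl⟩ := hP
  exact convex_convexHull _ _

theorem isCompact (hP : IsLatticePolygon P) : IsCompact P := by
  obtain ⟨V, hV, -, rfl⟩ := hP
  exact (hV.image latticeVec).isCompact_convexHull (𝕜 := ℝ)

theorem isClosed (hP : IsLatticePolygon P) : IsClosed P := hP.isCompact.isClosed

end IsLatticePolygon

/-- Translation invariant valuations on lattice polygons, normalized to vanish at points. -/
structure IsLatticeValuation (φ : Set (Fin 2 → ℝ) → ℝ) : Prop where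
  add_singleton : ∀ ⦃P⦄, IsLatticePolygon P → ∀ v, φ (P + {latticeVec v}) = φ P
  singleton : ∀ v, φ {latticeVec v} = 0
  union_add_inter : ∀ ⦃P Q⦄, IsLatticePolygon P → IsLatticePolygon Q →
    IsLatticePolygon (P ∪ Q) → IsLatticePolygon (P ∩ Q) → φ (P ∪ Q) + φ (P ∩ Q) = φ P + φ Q

theorem latticeHull_eq_of_subset {V W : Set (Fin 2 → ℤ)} (h : V ⊆ W)
    (h' : ∀ w ∈ W, latticeVec w ∈ latticeHull V) : latticeHull V = latticeHull W := by
  apply Set.Subset.antisymm (convexHull_mono (Set.image_mono h))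
  apply convexHull_min _ (convex_convexHull _ _)
  rintro _ ⟨w, hw, rfl⟩
  exact h' w hw

theorem subset_latticeHull {V : Set (Fin 2 → ℤ)} {v : Fin 2 → ℤ} (hv : v ∈ V) :
    latticeVec v ∈ latticeHull V :=
  subset_convexHull _ _ (Set.mem_image_of_mem _ hv)

theorem add_mem_latticeHull {V : Set (Fin 2 → ℤ)} {a b : Fin 2 → ℤ} (ha : a + a ∈ V)
    (hb : b + b ∈ V) : latticeVec (a + b) ∈ latticeHull V := by
  have := (convex_convexHull ℝ (latticeVec '' V)) (subset_latticeHull ha) (subset_latticeHull hb)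
    (a := 1 / 2) (b := 1 / 2) (by norm_num) (by norm_num) (by norm_num)
  rwa [show (1 / 2 : ℝ) • latticeVec (a + a) + (1 / 2 : ℝ) • latticeVec (b + b) =
    latticeVec (a + b) by simp only [map_add]; module] at this

namespace IsLatticeValuation

variable {φ : Set (Fin 2 → ℝ) → ℝ}

theorem latticeHull_union (hφ : IsLatticeValuation φ) (l : (Fin 2 → ℝ) →ₗ[ℝ] ℝ) (c : ℝ)
    {A B : Set (Fin 2 → ℤ)} {a b : Fin 2 → ℤ} (hAf : A.Finite) (hBf : B.Finite)
    (hA : ∀ v ∈ A, c ≤ l (latticeVec v)) (hB : ∀ v ∈ B, l (latticeVec v) ≤ c)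
    (haA : a ∈ A) (haB : a ∈ B) (hbA : b ∈ A) (hbB : b ∈ B)
    (h : ∀ x ∈ latticeHull (A ∪ B), l x = c → x ∈ segment ℝ (latticeVec a) (latticeVec b)) :
    φ (latticeHull (A ∪ B)) + φ (latticeHull {a, b}) =
      φ (latticeHull A) + φ (latticeHull B) := by
  have hA' : ∀ v ∈ latticeVec '' A, c ≤ l v := by rintro _ ⟨v, hv, rfl⟩; exact hA v hv
  have hB' : ∀ v ∈ latticeVec '' B, l v ≤ c := by rintro _ ⟨v, hv, rfl⟩; exact hB v hv
  rw [latticeHull, Set.image_union] at h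
  have hi := convexHull_inter_eq_segment l c hA' hB' (Set.mem_image_of_mem _ haA)
    (Set.mem_image_of_mem _ haB) (Set.mem_image_of_mem _ hbA) (Set.mem_image_of_mem _ hbB) h
  have hu := convexHull_union_eq_union l c hA' hB' (Set.mem_image_of_mem _ haA)
    (Set.mem_image_of_mem _ haB) (Set.mem_image_of_mem _ hbA) (Set.mem_image_of_mem _ hbB) h
  rw [← Set.image_union] at hu
  change latticeHull A ∩ latticeHull B = _ at hi
  change latticeHull (A ∪ B) = latticeHull A ∪ latticeHull B at hu
  rw [← latticeHull_pair] at hi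
  rw [hu, ← hi]
  apply hφ.union_add_inter (isLatticePolygon_latticeHull hAf ⟨a, haA⟩)
    (isLatticePolygon_latticeHull hBf ⟨a, haB⟩)
  · rw [← hu]
    exact isLatticePolygon_latticeHull (hAf.union hBf) ⟨a, Or.inl haA⟩
  · rw [hi]
    exact isLatticePolygon_latticeHull (by simp) ⟨a, by simp⟩

theorem latticeHull_image_add (hφ : IsLatticeValuation φ) {V : Set (Fin 2 → ℤ)} (hV : V.Finite)
    (hV' : V.Nonempty) (w : Fin 2 → ℤ) : φ (latticeHull ((· + w) '' V)) = φ (latticeHull V) := by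
  rw [_root_.latticeHull_image_add, hφ.add_singleton (isLatticePolygon_latticeHull hV hV')]

theorem latticeHull_pair_add (hφ : IsLatticeValuation φ) (a b w : Fin 2 → ℤ) :
    φ (latticeHull {a + w, b + w}) = φ (latticeHull {a, b}) := by
  rw [← hφ.latticeHull_image_add (V := {a, b}) (by simp) (by simp) w]
  simp [Set.image_insert_eq]

theorem latticeHull_triple_add (hφ : IsLatticeValuation φ) (a b c w : Fin 2 → ℤ) :
    φ (latticeHull {a + w, b + w, c + w}) = φ (latticeHull {a, b, c}) := by
  rw [← hφ.latticeHull_image_add (V := {a, b, c}) (by simp) (by simp) w]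
  simp [Set.image_insert_eq]

theorem latticeHull_singleton (hφ : IsLatticeValuation φ) (a : Fin 2 → ℤ) :
    φ (latticeHull {a}) = 0 := by
  rw [_root_.latticeHull_singleton, hφ.singleton]

theorem latticeHull_pair_add_self (hφ : IsLatticeValuation φ) (a b : Fin 2 → ℤ) :
    φ (latticeHull {a + a, b + b}) = 2 * φ (latticeHull {a, b}) := by
  by_cases hab : a = b
  · subst hab
    simp [hφ.latticeHull_singleton]
  have hne : latticeVec a ≠ latticeVec b := latticeVec_injective.ne hab
  obtain ⟨i, hi⟩ := Function.ne_iff.1 hne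
  obtain ⟨l, hl⟩ : ∃ l : (Fin 2 → ℝ) →ₗ[ℝ] ℝ, l (latticeVec a) = l (latticeVec b) + 1 := by
    refine ⟨(latticeVec a i - latticeVec b i)⁻¹ • LinearMap.proj i, ?_⟩
    have := sub_ne_zero.2 hi
    simp
    field_simp
    ring
  have hmid : latticeVec (b + a) ∈ latticeHull {a + a, b + b} :=
    add_mem_latticeHull (by simp) (by simp)
  have hunion : latticeHull {a + a, b + b} = latticeHull ({a + a, b + a} ∪ {b + a, b + b}) := by
    apply latticeHull_eq_of_subset
    · intro v; simp; tauto
    · rintro w ((rfl | rfl) | (rfl | rfl)) <;>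
        first | exact hmid | exact subset_latticeHull (by simp)
  have hcut := hφ.latticeHull_union l (l (latticeVec a) + l (latticeVec b))
    (A := {a + a, b + a}) (B := {b + a, b + b}) (a := b + a) (b := b + a) (by simp) (by simp)
    (by simp [hl, add_comm]) (by simp [hl, add_comm])
    (by simp) (by simp) (by simp) (by simp) ?_
  · have h1 : φ (latticeHull {a + a, b + a}) = φ (latticeHull {a, b}) := by
      rw [hφ.latticeHull_pair_add]
    have h2 : φ (latticeHull {b + a, b + b}) = φ (latticeHull {a, b}) := by
      rw [add_comm b a, hφ.latticeHull_pair_add]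
    rw [hunion]
    simp only [Set.pair_eq_singleton, hφ.latticeHull_singleton] at hcut
    linarith
  · intro x hx hlx
    rw [← hunion, latticeHull_pair] at hx
    obtain ⟨s, t, hs, ht, hst, rfl⟩ := hx
    simp only [map_add, map_smul, hl, smul_eq_mul] at hlx
    obtain rfl : t = 1 - s := by linarith
    obtain rfl : s = 1 / 2 := by linarith
    rw [segment_same, Set.mem_singleton_iff]
    simp only [map_add]
    module

end IsLatticeValuation

/-! ### Triangles -/

/-- Twice the signed area of the triangle `a b c`. -/
def cross (a b c : Fin 2 → ℤ) : ℤ :=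
  (b 0 - a 0) * (c 1 - a 1) - (b 1 - a 1) * (c 0 - a 0)

theorem cross_rotate (a b c : Fin 2 → ℤ) : cross b c a = cross a b c := by
  simp only [cross]; ring

theorem cross_swap (a b c : Fin 2 → ℤ) : cross a c b = -cross a b c := by
  simp only [cross]; ring

theorem cross_eq_zero_left (a b : Fin 2 → ℤ) : cross a b a = 0 := by
  simp [cross]

theorem cross_eq_zero_right (a b : Fin 2 → ℤ) : cross a b b = 0 := by
  simp only [cross]; ring

theorem cross_add_self (a b c : Fin 2 → ℤ) :
    cross (a + a) (b + b) (c + c) = 4 * cross a b c := by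
  simp only [cross, Pi.add_apply]; ring

theorem cross_neg (a b c : Fin 2 → ℤ) : cross (-a) (-b) (-c) = cross a b c := by
  simp only [cross, Pi.neg_apply]; ring

/-- The linear part of `fun v => cross b c v`. -/
def crossLinear (b c : Fin 2 → ℤ) : (Fin 2 → ℝ) →ₗ[ℝ] ℝ :=
  (latticeVec c 0 - latticeVec b 0) • LinearMap.proj 1 -
    (latticeVec c 1 - latticeVec b 1) • LinearMap.proj 0

theorem crossLinear_sub (b c v w : Fin 2 → ℤ) :
    crossLinear b c (latticeVec v) - crossLinear b c (latticeVec w) = cross b c v - cross b c w := by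
  simp [crossLinear, latticeVec, cross]
  ring

theorem exists_linear_of_cross_ne_zero {a b c : Fin 2 → ℤ} (h : cross a b c ≠ 0) :
    ∃ l : (Fin 2 → ℝ) →ₗ[ℝ] ℝ, l (latticeVec c) = l (latticeVec b) ∧
      l (latticeVec a) = l (latticeVec b) + 1 := by
  have h' : (cross b c a : ℝ) ≠ 0 := by rw [cross_rotate]; exact_mod_cast h
  refine ⟨(cross b c a : ℝ)⁻¹ • crossLinear b c, ?_, ?_⟩
  · have := crossLinear_sub b c c b
    rw [cross_eq_zero_left, cross_eq_zero_right, sub_self, sub_eq_zero] at this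
    simp [this]
  · have := crossLinear_sub b c a b
    rw [cross_eq_zero_left, Int.cast_zero, sub_zero, sub_eq_iff_eq_add'] at this
    simp only [LinearMap.smul_apply, smul_eq_mul, this, mul_add, inv_mul_cancel₀ h']

/-- The points of a doubled triangle at half height lie on a segment between two midpoints. -/
theorem mem_segment_of_mem_latticeHull_add_self {a b c : Fin 2 → ℤ} {l : (Fin 2 → ℝ) →ₗ[ℝ] ℝ}
    (hc : l (latticeVec c) = l (latticeVec b)) (ha : l (latticeVec a) = l (latticeVec b) + 1)
    {x : Fin 2 → ℝ} (hx : x ∈ latticeHull {a + a, b + b, c + c})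
    (hlx : l x = l (latticeVec a) + l (latticeVec b)) :
    x ∈ segment ℝ (latticeVec (a + b)) (latticeVec (a + c)) := by
  rw [latticeHull, Set.image_insert_eq, convexHull_insert (by simp), mem_convexJoin] at hx
  obtain ⟨p, hp, r, hr, hx⟩ := hx
  rw [Set.mem_singleton_iff] at hp
  subst hp
  change r ∈ latticeHull _ at hr
  rw [latticeHull_pair] at hr
  obtain ⟨u, v, hu, hv, huv, rfl⟩ := hr
  obtain ⟨s, t, hs, ht, hst, rfl⟩ := hx
  simp only [map_add, map_smul, hc, ha, smul_eq_mul] at hlx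
  obtain rfl : v = 1 - u := by linarith
  obtain rfl : t = 1 - s := by linarith
  obtain rfl : s = 1 / 2 := by linarith
  refine ⟨u, 1 - u, hu, hv, huv, ?_⟩
  simp only [map_add]
  module

namespace IsLatticeValuation

variable {φ : Set (Fin 2 → ℝ) → ℝ}

/-- A doubled triangle is cut by its midlines into three translates of the triangle and one of
its reflection. -/
theorem latticeHull_triple_add_self (hφ : IsLatticeValuation φ) {a b c : Fin 2 → ℤ}
    (h : cross a b c ≠ 0) :
    φ (latticeHull {a + a, b + b, c + c}) + φ (latticeHull {a, b}) + φ (latticeHull {a, c}) +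
      φ (latticeHull {b, c}) = 3 * φ (latticeHull {a, b, c}) + φ (latticeHull {-a, -b, -c}) := by
  obtain ⟨l₁, hc₁, ha₁⟩ := exists_linear_of_cross_ne_zero h
  obtain ⟨l₂, hc₂, ha₂⟩ := exists_linear_of_cross_ne_zero ((cross_rotate a b c).trans_ne h)
  obtain ⟨l₃, hc₃, ha₃⟩ := exists_linear_of_cross_ne_zero
    ((cross_rotate b c a).trans_ne ((cross_rotate a b c).trans_ne h))
  have hmid : ∀ v ∈ ({a + a, b + b, c + c, a + b, a + c, b + c} : Set (Fin 2 → ℤ)),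
      latticeVec v ∈ latticeHull {a + a, b + b, c + c} := by
    rintro v (rfl | rfl | rfl | rfl | rfl | rfl)
    iterate 3 exact subset_latticeHull (by simp)
    all_goals exact add_mem_latticeHull (by simp) (by simp)
  have hsub : ∀ V ⊆ ({a + a, b + b, c + c, a + b, a + c, b + c} : Set (Fin 2 → ℤ)),
      latticeHull V ⊆ latticeHull {a + a, b + b, c + c} := by
    intro V hV
    apply convexHull_min _ (convex_convexHull _ _)
    rintro _ ⟨v, hv, rfl⟩
    exact hmid v (hV hv)
  have cut₁ := hφ.latticeHull_union l₁ (l₁ (latticeVec a) + l₁ (latticeVec b))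
    (A := {a + a, a + b, a + c}) (B := {a + b, a + c, b + b, c + c}) (a := a + b) (b := a + c)
    (by simp) (by simp) (by simp [ha₁, hc₁]) (by simp [ha₁, hc₁])
    (by simp) (by simp) (by simp) (by simp)
    (fun x hx hlx => mem_segment_of_mem_latticeHull_add_self hc₁ ha₁
      (hsub _ (by intro v; simp; tauto) hx) hlx)
  have cut₂ := hφ.latticeHull_union l₂ (l₂ (latticeVec b) + l₂ (latticeVec c))
    (A := {b + b, b + c, b + a}) (B := {b + c, b + a, a + c, c + c}) (a := b + c) (b := b + a)
    (by simp) (by simp) (by simp [ha₂, hc₂]) (by simp [ha₂, hc₂])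
    (by simp) (by simp) (by simp) (by simp)
    (fun x hx hlx => mem_segment_of_mem_latticeHull_add_self hc₂ ha₂
      (by
        rw [show ({b + b, c + c, a + a} : Set (Fin 2 → ℤ)) = {a + a, b + b, c + c} by
          ext; simp; tauto]
        exact hsub _ (by intro v; simp [add_comm b a]; tauto) hx) hlx)
  have cut₃ := hφ.latticeHull_union l₃ (l₃ (latticeVec c) + l₃ (latticeVec a))
    (A := {c + c, c + a, c + b}) (B := {c + a, c + b, a + b}) (a := c + a) (b := c + b)
    (by simp) (by simp) (by simp [ha₃, hc₃]) (by simp [ha₃, hc₃])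
    (by simp) (by simp) (by simp) (by simp)
    (fun x hx hlx => mem_segment_of_mem_latticeHull_add_self hc₃ ha₃
      (by
        rw [show ({c + c, a + a, b + b} : Set (Fin 2 → ℤ)) = {a + a, b + b, c + c} by
          ext; simp; tauto]
        exact hsub _ (by intro v; simp [add_comm c a, add_comm c b]; tauto) hx) hlx)
  have e₁ : latticeHull {a + a, b + b, c + c} =
      latticeHull ({a + a, a + b, a + c} ∪ {a + b, a + c, b + b, c + c}) :=
    latticeHull_eq_of_subset (by intro v; simp; tauto)
      (fun w hw => hmid w (by revert hw; simp; tauto))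
  have e₂ : latticeHull {a + b, a + c, b + b, c + c} =
      latticeHull ({b + b, b + c, b + a} ∪ {b + c, b + a, a + c, c + c}) := by
    apply latticeHull_eq_of_subset
    · intro v; simp [add_comm b a]; tauto
    · intro w hw
      by_cases hbc : w = b + c
      · subst hbc; exact add_mem_latticeHull (by simp) (by simp)
      · exact subset_latticeHull (by revert hw; simp [hbc, add_comm b a]; tauto)
  have e₃ : latticeHull {b + c, b + a, a + c, c + c} =
      latticeHull ({c + c, c + a, c + b} ∪ {c + a, c + b, a + b}) := by
    congr 1
    ext v
    simp [add_comm b a, add_comm c a, add_comm c b]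
    tauto
  have t₁ := hφ.latticeHull_triple_add a b c a
  have t₂ := hφ.latticeHull_triple_add b c a b
  have t₃ := hφ.latticeHull_triple_add c a b c
  have t₄ := hφ.latticeHull_triple_add (-a) (-b) (-c) (a + b + c)
  have s₁ := hφ.latticeHull_pair_add b c a
  have s₂ := hφ.latticeHull_pair_add c a b
  have s₃ := hφ.latticeHull_pair_add a b c
  rw [show ({b, c, a} : Set (Fin 2 → ℤ)) = {a, b, c} by ext; simp; tauto] at t₂
  rw [show ({c, a, b} : Set (Fin 2 → ℤ)) = {a, b, c} by ext; simp; tauto] at t₃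
  rw [show ({-a + (a + b + c), -b + (a + b + c), -c + (a + b + c)} : Set (Fin 2 → ℤ)) =
    {c + a, c + b, a + b} by
      rw [show -a + (a + b + c) = c + b by ring, show -b + (a + b + c) = c + a by ring,
        show -c + (a + b + c) = a + b by ring]
      ext; simp; tauto] at t₄
  rw [Set.pair_comm c a] at s₂
  rw [← e₁] at cut₁
  rw [← e₂] at cut₂
  rw [← e₃] at cut₃
  simp only [add_comm b a, add_comm c a, add_comm c b] at *
  linarith

end IsLatticeValuation

/-! ### Decomposition of polygons into triangles -/

theorem exists_eq_add_smul_of_crossLinear_eq {a b : Fin 2 → ℤ} (hab : a ≠ b) {y : Fin 2 → ℝ}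
    (hy : crossLinear a b y = crossLinear a b (latticeVec a)) :
    ∃ t : ℝ, y = latticeVec a + t • (latticeVec b - latticeVec a) := by
  simp only [crossLinear, LinearMap.sub_apply, LinearMap.smul_apply, LinearMap.proj_apply,
    smul_eq_mul] at hy
  obtain ⟨i, hi⟩ := Function.ne_iff.1 (latticeVec_injective.ne hab)
  have hi' := sub_ne_zero.2 hi.symm
  refine ⟨(y i - latticeVec a i) / (latticeVec b i - latticeVec a i), ?_⟩
  ext j
  simp only [Pi.add_apply, Pi.smul_apply, Pi.sub_apply, smul_eq_mul]
  field_simp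
  fin_cases i <;> fin_cases j <;> simp <;> linarith

theorem mem_latticeHull_of_cross_eq_zero {a b c : Fin 2 → ℤ} (h : cross a b c = 0) :
    latticeVec a ∈ latticeHull {b, c} ∨ latticeVec b ∈ latticeHull {c, a} ∨
      latticeVec c ∈ latticeHull {a, b} := by
  by_cases hab : a = b
  · exact Or.inl (subset_latticeHull (by simp [hab]))
  have hl := crossLinear_sub a b c a
  rw [h, cross_eq_zero_left, sub_self, sub_eq_zero] at hl
  obtain ⟨t, ht⟩ := exists_eq_add_smul_of_crossLinear_eq hab hl
  have hcol : Collinear ℝ {latticeVec a, latticeVec b, latticeVec c} := by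
    rw [collinear_iff_of_mem (p₀ := latticeVec a) (by simp)]
    refine ⟨latticeVec b - latticeVec a, ?_⟩
    rintro p (rfl | rfl | rfl)
    · exact ⟨0, by simp⟩
    · exact ⟨1, by simp⟩
    · exact ⟨t, by rw [ht, vadd_eq_add, add_comm]⟩
  simp only [latticeHull_pair, mem_segment_iff_wbtw]
  rcases hcol.wbtw_or_wbtw_or_wbtw with h | h | h
  · exact Or.inr (Or.inl h.symm)
  · exact Or.inr (Or.inr h.symm)
  · exact Or.inl h.symm

/-- No point of `V` is in the convex hull of the others. -/
def LatticeIndependent (V : Set (Fin 2 → ℤ)) : Prop :=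
  ∀ v ∈ V, latticeVec v ∉ latticeHull (V \ {v})

namespace LatticeIndependent

variable {V : Set (Fin 2 → ℤ)}

theorem cross_ne_zero (hV : LatticeIndependent V) {a b c : Fin 2 → ℤ} (ha : a ∈ V) (hb : b ∈ V)
    (hc : c ∈ V) (hab : a ≠ b) (hac : a ≠ c) (hbc : b ≠ c) : cross a b c ≠ 0 := by
  intro h
  have key : ∀ x y z, x ∈ V → y ∈ V → z ∈ V → x ≠ y → x ≠ z →
      latticeVec x ∉ latticeHull {y, z} := by
    intro x y z hx hy hz hxy hxz hmem
    refine hV x hx (convexHull_mono (Set.image_mono ?_) hmem)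
    rintro w (rfl | rfl)
    exacts [⟨hy, hxy.symm⟩, ⟨hz, hxz.symm⟩]
  rcases mem_latticeHull_of_cross_eq_zero h with h | h | h
  · exact key a b c ha hb hc hab hac h
  · exact key b c a hb hc ha hbc hab.symm h
  · exact key c a b hc ha hb hac.symm hbc.symm h

theorem nonneg (hV : LatticeIndependent V) {a b : Fin 2 → ℤ} (ha : a ∈ V) (hb : b ∈ V)
    (hab : a ≠ b) {t : ℝ}
    (ht : latticeVec a + t • (latticeVec b - latticeVec a) ∈ latticeHull V) : 0 ≤ t := by
  refine nonneg_of_lineMap_mem_convexHull_insert (s := latticeVec '' (V \ {a}))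
    (Set.mem_image_of_mem _ ⟨hb, hab.symm⟩) (hV a ha) ?_
  rwa [← Set.image_insert_eq, Set.insert_sdiff_singleton, Set.insert_eq_of_mem ha]

theorem mem_segment (hV : LatticeIndependent V) {a b : Fin 2 → ℤ} (ha : a ∈ V) (hb : b ∈ V)
    (hab : a ≠ b) {y : Fin 2 → ℝ} (hy : y ∈ latticeHull V)
    (hl : crossLinear a b y = crossLinear a b (latticeVec a)) :
    y ∈ segment ℝ (latticeVec a) (latticeVec b) := by
  obtain ⟨t, rfl⟩ := exists_eq_add_smul_of_crossLinear_eq hab hl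
  have h0 := hV.nonneg ha hb hab hy
  have h1 : 0 ≤ 1 - t := by
    refine hV.nonneg hb ha hab.symm ?_
    convert hy using 1
    module
  exact ⟨1 - t, t, h1, h0, by ring, by module⟩

end LatticeIndependent

/-- Among the lines joining a point of four to the others, one separates the remaining two. -/
theorem exists_cross_mul_cross_neg {a b c d : Fin 2 → ℤ} (hbc : cross a b c ≠ 0)
    (hbd : cross a b d ≠ 0) (hcd : cross a c d ≠ 0) :
    cross a b c * cross a b d < 0 ∨ cross a c b * cross a c d < 0 ∨
      cross a d b * cross a d c < 0 := by
  rw [cross_swap a b c, cross_swap a b d, cross_swap a c d]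
  by_contra! h
  obtain ⟨h1, h2, h3⟩ := h
  rcases hbc.lt_or_gt with p | p <;> rcases hbd.lt_or_gt with q | q <;>
    rcases hcd.lt_or_gt with r | r <;> nlinarith

namespace IsLatticeValuation

variable {φ : Set (Fin 2 → ℝ) → ℝ}

theorem latticeHull_eq_zero_of_cross (hφ : IsLatticeValuation φ)
    (hseg : ∀ a b, φ (latticeHull {a, b}) = 0) {V : Finset (Fin 2 → ℤ)}
    (hV : LatticeIndependent (V : Set (Fin 2 → ℤ)))
    (ih : ∀ W ⊂ V, W.Nonempty → φ (latticeHull W) = 0) {a b c d : Fin 2 → ℤ} (ha : a ∈ V)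
    (hb : b ∈ V) (hc : c ∈ V) (hd : d ∈ V) (hab : a ≠ b) (hneg : cross a b c < 0)
    (hpos : 0 < cross a b d) : φ (latticeHull V) = 0 := by
  classical
  have hcross : ∀ v, crossLinear a b (latticeVec v) =
      crossLinear a b (latticeVec a) + cross a b v := by
    intro v
    have := crossLinear_sub a b v a
    rw [cross_eq_zero_left, Int.cast_zero] at this
    linarith
  have hsplit : ((V.filter (0 ≤ cross a b ·) : Finset _) : Set (Fin 2 → ℤ)) ∪
      (V.filter (cross a b · ≤ 0) : Finset _) = V := by
    ext v
    have := le_total 0 (cross a b v)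
    simp only [Finset.coe_filter, Set.mem_union, Set.mem_ofPred_eq, Finset.mem_coe]
    tauto
  have hcut := hφ.latticeHull_union (crossLinear a b) (crossLinear a b (latticeVec a))
    (A := (V.filter (0 ≤ cross a b ·) : Finset _)) (B := (V.filter (cross a b · ≤ 0) : Finset _))
    (a := a) (b := b) (Finset.finite_toSet _) (Finset.finite_toSet _)
    (by
      intro v hv
      rw [hcross v, le_add_iff_nonneg_right]
      exact_mod_cast (Finset.mem_filter.1 hv).2)
    (by
      intro v hv
      rw [hcross v, add_le_iff_nonpos_right]
      exact_mod_cast (Finset.mem_filter.1 hv).2)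
    (by simp [ha, cross_eq_zero_left]) (by simp [ha, cross_eq_zero_left])
    (by simp [hb, cross_eq_zero_right]) (by simp [hb, cross_eq_zero_right])
    (by
      rw [hsplit]
      exact fun y hy hl => hV.mem_segment ha hb hab hy hl)
  rw [hsplit, hseg, ih _ (Finset.filter_ssubset.2 ⟨c, hc, hneg.not_ge⟩)
      ⟨a, by simp [ha, cross_eq_zero_left]⟩,
    ih _ (Finset.filter_ssubset.2 ⟨d, hd, hpos.not_ge⟩) ⟨a, by simp [ha, cross_eq_zero_left]⟩]
    at hcut
  linarith

theorem latticeHull_eq_zero_of_cross_mul (hφ : IsLatticeValuation φ)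
    (hseg : ∀ a b, φ (latticeHull {a, b}) = 0) {V : Finset (Fin 2 → ℤ)}
    (hV : LatticeIndependent (V : Set (Fin 2 → ℤ)))
    (ih : ∀ W ⊂ V, W.Nonempty → φ (latticeHull W) = 0) {a b c d : Fin 2 → ℤ} (ha : a ∈ V)
    (hb : b ∈ V) (hc : c ∈ V) (hd : d ∈ V) (hab : a ≠ b)
    (hneg : cross a b c * cross a b d < 0) : φ (latticeHull V) = 0 := by
  rcases mul_neg_iff.1 hneg with ⟨h1, h2⟩ | ⟨h1, h2⟩
  · exact hφ.latticeHull_eq_zero_of_cross hseg hV ih ha hb hd hc hab h2 h1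
  · exact hφ.latticeHull_eq_zero_of_cross hseg hV ih ha hb hc hd hab h1 h2

/-- A valuation which vanishes on segments and triangles vanishes. -/
theorem eq_zero_of_triangles (hφ : IsLatticeValuation φ)
    (hseg : ∀ a b, φ (latticeHull {a, b}) = 0)
    (htri : ∀ a b c, cross a b c ≠ 0 → φ (latticeHull {a, b, c}) = 0)
    {P : Set (Fin 2 → ℝ)} (hP : IsLatticePolygon P) : φ P = 0 := by
  classical
  obtain ⟨V, hVf, hV', rfl⟩ := hP
  lift V to Finset (Fin 2 → ℤ) using hVf
  rw [Finset.coe_nonempty] at hV'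
  induction V using Finset.strongInduction with
  | H V ih =>
    by_cases hV : LatticeIndependent (V : Set (Fin 2 → ℤ))
    · obtain ⟨a, ha⟩ := hV'
      rcases lt_or_ge 2 (V.erase a).card with h | h
      · obtain ⟨b, c, d, hb, hc, hd, hbc, hbd, hcd⟩ := Finset.two_lt_card_iff.1 h
        rw [Finset.mem_erase] at hb hc hd
        rcases exists_cross_mul_cross_neg
          (hV.cross_ne_zero ha hb.2 hc.2 hb.1.symm hc.1.symm hbc)
          (hV.cross_ne_zero ha hb.2 hd.2 hb.1.symm hd.1.symm hbd)
          (hV.cross_ne_zero ha hc.2 hd.2 hc.1.symm hd.1.symm hcd) with h | h | h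
        · exact hφ.latticeHull_eq_zero_of_cross_mul hseg hV ih ha hb.2 hc.2 hd.2 hb.1.symm h
        · exact hφ.latticeHull_eq_zero_of_cross_mul hseg hV ih ha hc.2 hb.2 hd.2 hc.1.symm h
        · exact hφ.latticeHull_eq_zero_of_cross_mul hseg hV ih ha hd.2 hb.2 hc.2 hd.1.symm h
      · rw [← Finset.insert_erase ha]
        interval_cases h' : (V.erase a).card
        · rw [Finset.card_eq_zero.1 h']
          simp [hφ.latticeHull_singleton]
        · obtain ⟨b, hb⟩ := Finset.card_eq_one.1 h'
          rw [hb]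
          simpa using hseg a b
        · obtain ⟨b, c, hbc, hb⟩ := Finset.card_eq_two.1 h'
          have hbV : b ∈ V.erase a := by simp [hb]
          have hcV : c ∈ V.erase a := by simp [hb]
          rw [Finset.mem_erase] at hbV hcV
          rw [hb]
          simpa using htri a b c
            (hV.cross_ne_zero ha hbV.2 hcV.2 hbV.1.symm hcV.1.symm hbc)
    · simp only [LatticeIndependent, not_forall, not_not] at hV
      obtain ⟨v, hv, hmem⟩ := hV
      rw [← Finset.coe_erase] at hmem
      rw [← latticeHull_eq_of_subset (V := (V.erase v : Finset _)) (W := V)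
        (by simp)
        (fun w hw => if h : w = v then h ▸ hmem else
          subset_latticeHull (Finset.mem_erase.2 ⟨h, hw⟩))]
      refine ih _ (Finset.erase_ssubset hv) ?_
      rw [Finset.nonempty_iff_ne_empty]
      intro h
      simp [h, latticeHull] at hmem

end IsLatticeValuation

/-! ### Valuations and dilations -/

theorem two_smul_latticeHull_pair (a b : Fin 2 → ℤ) :
    (2 : ℝ) • latticeHull {a, b} = latticeHull {a + a, b + b} := by
  rw [← latticeHull_image_add_self]
  simp [Set.image_insert_eq]

theorem two_smul_latticeHull_triple (a b c : Fin 2 → ℤ) :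
    (2 : ℝ) • latticeHull {a, b, c} = latticeHull {a + a, b + b, c + c} := by
  rw [← latticeHull_image_add_self]
  simp [Set.image_insert_eq]

theorem isLatticePolygon_pair (a b : Fin 2 → ℤ) : IsLatticePolygon (latticeHull {a, b}) :=
  isLatticePolygon_latticeHull (by simp) (by simp)

theorem isLatticePolygon_triple (a b c : Fin 2 → ℤ) : IsLatticePolygon (latticeHull {a, b, c}) :=
  isLatticePolygon_latticeHull (by simp) (by simp)

/-- The values of `φ` at a triangle and its reflection, minus the values at the edges. -/
def triangleDefect (φ : Set (Fin 2 → ℝ) → ℝ) (a b c : Fin 2 → ℤ) : ℝ :=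
  φ (latticeHull {a, b, c}) + φ (latticeHull {-a, -b, -c}) -
    (φ (latticeHull {a, b}) + φ (latticeHull {a, c}) + φ (latticeHull {b, c}))

/-- The deviation of `φ` from Minkowski additivity. -/
def minkowskiDefect (φ : Set (Fin 2 → ℝ) → ℝ) (Q P : Set (Fin 2 → ℝ)) : ℝ :=
  φ (P + Q) - φ P - φ Q

theorem minkowskiDefect_comm (φ : Set (Fin 2 → ℝ) → ℝ) (P Q : Set (Fin 2 → ℝ)) :
    minkowskiDefect φ Q P = minkowskiDefect φ P Q := by
  rw [minkowskiDefect, minkowskiDefect, add_comm P Q]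
  ring

namespace IsLatticeValuation

variable {φ χ : Set (Fin 2 → ℝ) → ℝ}

theorem add (hφ : IsLatticeValuation φ) (hχ : IsLatticeValuation χ) :
    IsLatticeValuation (fun P => φ P + χ P) where
  add_singleton P hP v := by rw [hφ.add_singleton hP, hχ.add_singleton hP]
  singleton v := by rw [hφ.singleton, hχ.singleton, add_zero]
  union_add_inter P Q hP hQ hu hi := by
    linarith [hφ.union_add_inter hP hQ hu hi, hχ.union_add_inter hP hQ hu hi]

theorem two_smul_sub (hφ : IsLatticeValuation φ) :
    IsLatticeValuation (fun P => φ ((2 : ℝ) • P) - 2 * φ P) where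
  add_singleton P hP v := by
    rw [hφ.add_singleton hP, smul_add, Set.smul_set_singleton,
      show (2 : ℝ) • latticeVec v = latticeVec (v + v) by rw [map_add, two_smul],
      hφ.add_singleton hP.two_smul]
  singleton v := by
    rw [hφ.singleton, Set.smul_set_singleton,
      show (2 : ℝ) • latticeVec v = latticeVec (v + v) by rw [map_add, two_smul], hφ.singleton]
    ring
  union_add_inter P Q hP hQ hu hi := by
    have h := hu.two_smul
    have h' := hi.two_smul
    rw [Set.smul_set_union] at h ⊢
    rw [Set.smul_set_inter₀ two_ne_zero] at h' ⊢
    linarith [hφ.union_add_inter hP hQ hu hi,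
      hφ.union_add_inter hP.two_smul hQ.two_smul h h']

theorem minkowskiDefect (hφ : IsLatticeValuation φ) {Q : Set (Fin 2 → ℝ)}
    (hQ : IsLatticePolygon Q) : IsLatticeValuation (minkowskiDefect φ Q) where
  add_singleton P hP v := by
    rw [_root_.minkowskiDefect, _root_.minkowskiDefect, hφ.add_singleton hP, add_right_comm,
      hφ.add_singleton (hP.add hQ)]
  singleton v := by
    rw [_root_.minkowskiDefect, add_comm, hφ.add_singleton hQ, hφ.singleton]
    ring
  union_add_inter P R hP hR hu hi := by
    have h := hu.add hQ
    have h' := hi.add hQ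
    simp only [_root_.minkowskiDefect]
    have := hφ.union_add_inter hP hR hu hi
    rw [inter_add_of_convex_union hP.isClosed hR.isClosed hQ.convex hu.convex] at h' ⊢
    rw [Set.union_add] at h ⊢
    linarith [hφ.union_add_inter (hP.add hQ) (hR.add hQ) h h']

theorem latticeHull_triple_add_self_eq_defect (hφ : IsLatticeValuation φ) {a b c : Fin 2 → ℤ}
    (h : cross a b c ≠ 0) : φ (latticeHull {a + a, b + b, c + c}) =
      2 * φ (latticeHull {a, b, c}) + triangleDefect φ a b c := by
  rw [triangleDefect]
  linarith [hφ.latticeHull_triple_add_self h]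

theorem latticeHull_pair_neg (hφ : IsLatticeValuation φ) (a b : Fin 2 → ℤ) :
    φ (latticeHull {-a, -b}) = φ (latticeHull {a, b}) := by
  rw [← hφ.latticeHull_pair_add (-a) (-b) (a + b), Set.pair_comm a b, neg_add_cancel_left,
    add_comm a b, neg_add_cancel_left]

theorem triangleDefect_add_self (hφ : IsLatticeValuation φ) {a b c : Fin 2 → ℤ}
    (h : cross a b c ≠ 0) :
    triangleDefect φ (a + a) (b + b) (c + c) = 4 * triangleDefect φ a b c := by
  have h1 := hφ.latticeHull_triple_add_self_eq_defect h
  have h2 := hφ.latticeHull_triple_add_self_eq_defect ((cross_neg a b c).trans_ne h)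
  simp only [triangleDefect, neg_add, neg_neg, hφ.latticeHull_pair_neg, hφ.latticeHull_pair_add_self] at *
  linarith

/-- A valuation which is homogeneous, of a degree which does not occur, vanishes. -/
theorem eq_zero_of_two_smul (hφ : IsLatticeValuation φ) {r : ℝ} (h2 : r ≠ 2) (h4 : r ≠ 4)
    (h : ∀ P, IsLatticePolygon P → φ ((2 : ℝ) • P) = r * φ P) {P : Set (Fin 2 → ℝ)}
    (hP : IsLatticePolygon P) : φ P = 0 := by
  have key : ∀ {s x : ℝ}, r ≠ s → s * x = r * x → x = 0 := fun hs hx =>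
    (mul_eq_mul_right_iff.1 hx).resolve_left hs.symm
  have hseg : ∀ a b, φ (latticeHull {a, b}) = 0 := by
    intro a b
    apply key h2
    rw [← hφ.latticeHull_pair_add_self, ← two_smul_latticeHull_pair, h _ (isLatticePolygon_pair a b)]
  refine hφ.eq_zero_of_triangles hseg (fun a b c habc => ?_) hP
  have hdefect : triangleDefect φ a b c = 0 := by
    apply key h4
    rw [← hφ.triangleDefect_add_self habc]
    simp only [triangleDefect, hseg]
    simp only [neg_add, ← two_smul_latticeHull_triple, h _ (isLatticePolygon_triple _ _ _)]
    ring
  apply key h2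
  rw [← h _ (isLatticePolygon_triple a b c), two_smul_latticeHull_triple,
    hφ.latticeHull_triple_add_self_eq_defect habc, hdefect, add_zero]

theorem triangleDefect_two_pow_nsmul (hφ : IsLatticeValuation φ) {a b c : Fin 2 → ℤ}
    (h : cross a b c ≠ 0) (n : ℕ) :
    triangleDefect φ (2 ^ n • a) (2 ^ n • b) (2 ^ n • c) = 4 ^ n * triangleDefect φ a b c := by
  induction n generalizing a b c with
  | zero => simp
  | succ n ih =>
    have h' : cross (a + a) (b + b) (c + c) ≠ 0 := by
      rw [cross_add_self]; exact mul_ne_zero four_ne_zero h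
    rw [pow_succ, mul_smul, mul_smul, mul_smul, two_nsmul, two_nsmul, two_nsmul, ih h',
      hφ.triangleDefect_add_self h]
    ring

/-- A valuation of subquadratic growth is homogeneous of degree one. -/
theorem two_smul_of_tendsto (hφ : IsLatticeValuation φ)
    (h : ∀ P, IsLatticePolygon P →
      Tendsto (fun n : ℕ => φ (((2 ^ n : ℕ) : ℝ) • P) / 4 ^ n) atTop (𝓝 0))
    {P : Set (Fin 2 → ℝ)} (hP : IsLatticePolygon P) : φ ((2 : ℝ) • P) = 2 * φ P := by
  refine sub_eq_zero.1 (hφ.two_smul_sub.eq_zero_of_triangles (fun a b => ?_)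
    (fun a b c habc => ?_) hP)
  · rw [two_smul_latticeHull_pair, hφ.latticeHull_pair_add_self, sub_self]
  · rw [two_smul_latticeHull_triple, hφ.latticeHull_triple_add_self_eq_defect habc,
      add_sub_cancel_left]
    have hlim := ((h _ (isLatticePolygon_triple a b c)).add
      (h _ (isLatticePolygon_triple (-a) (-b) (-c)))).sub
      (((h _ (isLatticePolygon_pair a b)).add (h _ (isLatticePolygon_pair a c))).add
        (h _ (isLatticePolygon_pair b c)))
    simp only [add_zero, sub_zero] at hlim
    refine tendsto_nhds_unique (tendsto_const_nhds.congr fun n => ?_) hlim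
    have := hφ.triangleDefect_two_pow_nsmul habc n
    simp only [← latticeHull_image_nsmul, Set.image_insert_eq, Set.image_singleton, smul_neg]
    rw [triangleDefect] at this
    field_simp
    linarith

/-- A valuation which is homogeneous of degree one is Minkowski additive. -/
theorem minkowskiDefect_eq_zero (hφ : IsLatticeValuation φ)
    (h : ∀ P, IsLatticePolygon P → φ ((2 : ℝ) • P) = 2 * φ P) {P Q : Set (Fin 2 → ℝ)}
    (hP : IsLatticePolygon P) (hQ : IsLatticePolygon Q) : _root_.minkowskiDefect φ Q P = 0 := by
  have hdil : ∀ {R S}, IsLatticePolygon R → IsLatticePolygon S →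
      _root_.minkowskiDefect φ ((2 : ℝ) • S) ((2 : ℝ) • R) =
        2 * _root_.minkowskiDefect φ S R := by
    intro R S hR hS
    rw [_root_.minkowskiDefect, ← smul_add, h _ (hR.add hS), h _ hR, h _ hS,
      _root_.minkowskiDefect]
    ring
  have hseg : ∀ a b S, IsLatticePolygon S →
      _root_.minkowskiDefect φ S (latticeHull {a, b}) = 0 := by
    intro a b S hS
    rw [minkowskiDefect_comm]
    refine (hφ.minkowskiDefect (isLatticePolygon_pair a b)).eq_zero_of_two_smul (r := 1)
      (by norm_num) (by norm_num) (fun R hR => ?_) hS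
    have h1 := (hφ.minkowskiDefect hR.two_smul).latticeHull_pair_add_self a b
    rw [← two_smul_latticeHull_pair, hdil (isLatticePolygon_pair a b) hR] at h1
    rw [minkowskiDefect_comm, minkowskiDefect_comm φ R]
    linarith
  refine (hφ.minkowskiDefect hQ).eq_zero_of_triangles (fun a b => hseg a b Q hQ)
    (fun a b c habc => ?_) hP
  have hT := isLatticePolygon_triple a b c
  have hT' := isLatticePolygon_triple (-a) (-b) (-c)
  have hdefect : ∀ S, IsLatticePolygon S →
      triangleDefect (_root_.minkowskiDefect φ S) a b c = 0 := by
    intro S hS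
    have hval : ∀ R, IsLatticePolygon R → triangleDefect (_root_.minkowskiDefect φ R) a b c =
        _root_.minkowskiDefect φ (latticeHull {a, b, c}) R +
          _root_.minkowskiDefect φ (latticeHull {-a, -b, -c}) R := by
      intro R hR
      simp only [triangleDefect, hseg _ _ R hR, minkowskiDefect_comm φ R]
      ring
    rw [hval S hS]
    refine ((hφ.minkowskiDefect hT).add (hφ.minkowskiDefect hT')).eq_zero_of_two_smul
      (r := 1 / 2) (by norm_num) (by norm_num) (fun R hR => ?_) hS
    rw [← hval _ hR.two_smul, ← hval _ hR]
    have h1 := (hφ.minkowskiDefect hR.two_smul).triangleDefect_add_self habc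
    have h2 : triangleDefect (_root_.minkowskiDefect φ ((2 : ℝ) • R)) (a + a) (b + b) (c + c) =
        2 * triangleDefect (_root_.minkowskiDefect φ R) a b c := by
      simp only [triangleDefect, hseg _ _ _ hR, hseg _ _ _ hR.two_smul]
      simp only [neg_add, ← two_smul_latticeHull_triple, hdil (isLatticePolygon_triple _ _ _) hR]
      ring
    linarith
  rw [minkowskiDefect_comm]
  refine (hφ.minkowskiDefect hT).eq_zero_of_two_smul (r := 1) (by norm_num) (by norm_num)
    (fun R hR => ?_) hQ
  have h1 := (hφ.minkowskiDefect hR.two_smul).latticeHull_triple_add_self_eq_defect habc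
  rw [hdefect _ hR.two_smul, ← two_smul_latticeHull_triple, hdil hT hR] at h1
  rw [minkowskiDefect_comm, minkowskiDefect_comm φ R]
  linarith

end IsLatticeValuation

/-! ### Lattice points and volume -/

theorem IsLatticePolygon.finite_lattice {P : Set (Fin 2 → ℝ)} (hP : IsLatticePolygon P) :
    {a : Fin 2 → ℤ | latticeVec a ∈ P}.Finite := by
  obtain ⟨r, hr⟩ := hP.isCompact.isBounded.subset_closedBall 0
  refine (Set.finite_Icc (fun _ => -⌈r⌉) (fun _ => ⌈r⌉)).subset fun a ha => ?_
  have h := mem_closedBall_zero_iff.1 (hr ha)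
  have key : ∀ i, |(a i : ℝ)| ≤ ⌈r⌉ := fun i =>
    ((norm_le_pi_norm (latticeVec a) i).trans h).trans (Int.le_ceil r)
  refine ⟨fun i => ?_, fun i => ?_⟩
  · exact_mod_cast (abs_le.1 (key i)).1
  · exact_mod_cast (abs_le.1 (key i)).2

theorem latticeCount_eq (P : Set (Fin 2 → ℝ)) :
    latticeCount P = {a : Fin 2 → ℤ | latticeVec a ∈ P}.ncard := rfl

theorem latticeCount_add_singleton (P : Set (Fin 2 → ℝ)) (v : Fin 2 → ℤ) :
    latticeCount (P + {latticeVec v}) = latticeCount P := by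
  rw [latticeCount_eq, latticeCount_eq,
    ← Set.ncard_image_of_injective {a | latticeVec a ∈ P} (add_left_injective v)]
  congr 1
  ext a
  simp only [Set.add_singleton, Set.image_add_right, Set.mem_preimage, Set.mem_ofPred_eq, map_add,
    map_neg]

theorem latticeCount_singleton (v : Fin 2 → ℤ) : latticeCount {latticeVec v} = 1 := by
  rw [latticeCount_eq]
  simp [latticeVec_injective.eq_iff]

theorem latticeCount_union_add_inter {P Q : Set (Fin 2 → ℝ)} (hP : IsLatticePolygon P)
    (hQ : IsLatticePolygon Q) :
    latticeCount (P ∪ Q) + latticeCount (P ∩ Q) = latticeCount P + latticeCount Q :=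
  Set.ncard_union_add_ncard_inter _ _ hP.finite_lattice hQ.finite_lattice

/-- The excess of the number of lattice points over the area. -/
noncomputable def latticeExcess (P : Set (Fin 2 → ℝ)) : ℝ :=
  latticeCount P - (volume P).toReal - 1

theorem isLatticeValuation_latticeExcess : IsLatticeValuation latticeExcess where
  add_singleton P _ v := by
    rw [latticeExcess, latticeExcess, latticeCount_add_singleton, Set.add_singleton,
      Set.image_add_right, measure_preimage_add_right]
  singleton v := by
    simp [latticeExcess, latticeCount_singleton]
  union_add_inter P Q hP hQ _ _ := by
    have h1 : (latticeCount (P ∪ Q) + latticeCount (P ∩ Q) : ℝ) =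
        latticeCount P + latticeCount Q := by
      exact_mod_cast latticeCount_union_add_inter hP hQ
    have h2 := measureReal_union_add_inter (μ := volume) (s := P) hQ.isClosed.measurableSet
      hP.isCompact.measure_ne_top hQ.isCompact.measure_ne_top
    simp only [measureReal_def] at h2
    simp only [latticeExcess]
    linarith

theorem mem_span_basisFun_iff (x : Fin 2 → ℝ) :
    x ∈ Submodule.span ℤ (Set.range (Pi.basisFun ℝ (Fin 2))) ↔ ∃ a, latticeVec a = x := by
  rw [Module.Basis.mem_span_iff_repr_mem]
  simp only [Pi.basisFun_repr, Set.mem_range, algebraMap_int_eq, Int.coe_castRingHom]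
  constructor
  · intro h
    choose a ha using h
    exact ⟨a, funext ha⟩
  · rintro ⟨a, rfl⟩ i
    exact ⟨a i, rfl⟩

theorem card_inter_inv_smul_span (P : Set (Fin 2 → ℝ)) {n : ℕ} (hn : n ≠ 0) :
    Nat.card ↑(P ∩ (n : ℝ)⁻¹ • (Submodule.span ℤ (Set.range (Pi.basisFun ℝ (Fin 2))) :
      Set (Fin 2 → ℝ))) = latticeCount ((n : ℝ) • P) := by
  have hn' : (n : ℝ) ≠ 0 := Nat.cast_ne_zero.2 hn
  rw [latticeCount_eq, Nat.card_coe_set_eq, ← Set.ncard_image_of_injective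
    {a | latticeVec a ∈ (n : ℝ) • P} (f := fun a => (n : ℝ)⁻¹ • latticeVec a)
    ((smul_right_injective _ (inv_ne_zero hn')).comp latticeVec_injective)]
  congr 1
  ext x
  simp only [Set.mem_inter_iff, Set.mem_inv_smul_set_iff₀ hn', SetLike.mem_coe,
    mem_span_basisFun_iff, Set.mem_image, Set.mem_ofPred_eq]
  constructor
  · rintro ⟨hx, a, ha⟩
    exact ⟨a, by rw [ha]; exact Set.smul_mem_smul_set hx, by rw [ha, inv_smul_smul₀ hn']⟩
  · rintro ⟨a, ha, rfl⟩
    exact ⟨(Set.mem_smul_set_iff_inv_smul_mem₀ hn' _ _).1 ha, a, by rw [smul_inv_smul₀ hn']⟩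

theorem tendsto_latticeExcess {P : Set (Fin 2 → ℝ)} (hP : IsLatticePolygon P) :
    Tendsto (fun n : ℕ => latticeExcess (((2 ^ n : ℕ) : ℝ) • P) / 4 ^ n) atTop (𝓝 0) := by
  have h := tendsto_card_div_pow_atTop_volume P hP.isCompact.isBounded
    hP.isClosed.measurableSet (hP.convex.addHaar_frontier volume)
  have h2 := h.comp (tendsto_pow_atTop_atTop_of_one_lt (one_lt_two : (1 : ℕ) < 2))
  have h3 : Tendsto (fun n : ℕ => ((4 : ℝ) ^ n)⁻¹) atTop (𝓝 0) :=
    (tendsto_pow_atTop_atTop_of_one_lt (by norm_num)).inv_tendsto_atTop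
  have h4 := (h2.sub_const (volume.real P)).sub h3
  rw [sub_self, sub_zero] at h4
  refine h4.congr fun n => ?_
  have hpow : ((2 : ℝ) ^ n) ^ 2 = 4 ^ n := by rw [← pow_mul, mul_comm, pow_mul]; norm_num
  simp only [Function.comp_apply]
  rw [card_inter_inv_smul_span P (pow_ne_zero n two_ne_zero), latticeExcess,
    Measure.addHaar_smul, ENNReal.toReal_mul, ENNReal.toReal_ofReal (abs_nonneg _), measureReal_def]
  simp only [Fintype.card_fin, Module.finrank_fin_fun, Nat.cast_pow, Nat.cast_ofNat, hpow]
  rw [abs_of_pos (by positivity)]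
  field_simp

/-- For compact convex lattice polygons `P₁, P₂ ⊆ ℝ²`,
`|(P₁+P₂) ∩ ℤ²| = |P₁ ∩ ℤ²| + |P₂ ∩ ℤ²| + (vol(P₁+P₂) − vol(P₁) − vol(P₂)) − 1`. -/
theorem latticeCount_minkowski_sum
    (P₁ P₂ : Set (Fin 2 → ℝ)) (V₁ V₂ : Finset (Fin 2 → ℤ))
    (hV₁ : V₁.Nonempty) (hV₂ : V₂.Nonempty)
    (hP₁ : P₁ = convexHull ℝ ((fun (a : Fin 2 → ℤ) (i : Fin 2) => (a i : ℝ)) '' ↑V₁))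
    (hP₂ : P₂ = convexHull ℝ ((fun (a : Fin 2 → ℤ) (i : Fin 2) => (a i : ℝ)) '' ↑V₂)) :
    (latticeCount (P₁ + P₂) : ℝ) =
      (latticeCount P₁ : ℝ) + (latticeCount P₂ : ℝ)
        + ((volume (P₁ + P₂)).toReal - (volume P₁).toReal - (volume P₂).toReal)
        - 1 := by
  have h₁ : IsLatticePolygon P₁ := ⟨V₁, V₁.finite_toSet, hV₁, hP₁.symm⟩
  have h₂ : IsLatticePolygon P₂ := ⟨V₂, V₂.finite_toSet, hV₂, hP₂.symm⟩
  have h := isLatticeValuation_latticeExcess.minkowskiDefect_eq_zero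
    (fun P hP => isLatticeValuation_latticeExcess.two_smul_of_tendsto
      (fun Q hQ => tendsto_latticeExcess hQ) hP) h₁ h₂
  simp only [minkowskiDefect, latticeExcess] at h
  linarith
end

section
/- Let P ⊂ ℝ² be a compact triangle, i.e. the convex hull of three affinely independent points, and let A, B ⊂ ℝ² be nonempty finite sets. Then l_{P,A+B} = l_{P,A} + l_{P,B}, where A + B is the Minkowski sum. -/
open Pointwise

/-- `l_{P,A}`: the smallest `l ≥ 0` such that `A ⊆ l·P + v` for some `v ∈ ℝ²`. -/
noncomputable def lScale (P A : Set (Fin 2 → ℝ)) : ℝ :=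
  sInf {l : ℝ | 0 ≤ l ∧ ∃ v : Fin 2 → ℝ, A ⊆ (fun x => l • x + v) '' P}

namespace AffineBasis

variable {ι E : Type*} [AddCommGroup E] [Module ℝ E] (b : AffineBasis ι ℝ E)

theorem coord_eq_linear_add (i : ι) (x : E) :
    b.coord i x = (b.coord i).linear x + b.coord i 0 := by
  simpa using (b.coord i).map_vadd 0 x

variable [Fintype ι]

theorem sum_coord_linear_eq_zero (x : E) : ∑ i, (b.coord i).linear x = 0 := by
  have h := b.sum_coord_apply_eq_one x
  simp only [b.coord_eq_linear_add _ x, Finset.sum_add_distrib, b.sum_coord_apply_eq_one] at h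
  linarith

theorem eq_zero_of_coord_linear_eq_zero {x : E} (h : ∀ i, (b.coord i).linear x = 0) : x = 0 := by
  apply b.ext_elem
  intro i
  rw [b.coord_eq_linear_add i x, h i, zero_add]

theorem exists_coord_linear_eq (t : ι → ℝ) (ht : ∑ i, t i = 0) :
    ∃ v : E, ∀ i, (b.coord i).linear v = t i := by
  classical
  refine ⟨∑ j, t j • b j, fun i => ?_⟩
  have h (j : ι) : (b.coord i).linear (b j) = (if i = j then 1 else 0) - b.coord i 0 := by
    rw [← b.coord_apply i j, b.coord_eq_linear_add i (b j), add_sub_cancel_right]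
  simp only [map_sum, map_smul, smul_eq_mul, h, mul_sub, Finset.sum_sub_distrib, ← Finset.sum_mul, ht]
  simp

theorem mem_homothetic_convexHull_iff {l : ℝ} (hl : 0 ≤ l) (v x : E) :
    x ∈ (fun y => l • y + v) '' convexHull ℝ (Set.range b) ↔
      ∀ i, 0 ≤ (b.coord i).linear (x - v) + l * b.coord i 0 := by
  rw [b.convexHull_eq_nonneg_coord]
  constructor
  · rintro ⟨y, hy, rfl⟩ i
    have := mul_nonneg hl (hy i)
    rw [b.coord_eq_linear_add i y] at this
    simpa [mul_add] using this
  · intro h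
    rcases hl.eq_or_lt with rfl | hl
    · have hx : x - v = 0 := b.eq_zero_of_coord_linear_eq_zero fun i =>
        (Finset.sum_eq_zero_iff_of_nonneg (fun i _ => by simpa using h i)).1
          (b.sum_coord_linear_eq_zero (x - v)) i (Finset.mem_univ i)
      classical
      obtain ⟨j⟩ := b.nonempty
      refine ⟨b j, fun i => ?_, by simp [sub_eq_zero.1 hx]⟩
      rw [b.coord_apply]
      split_ifs <;> simp
    · refine ⟨l⁻¹ • (x - v), fun i => ?_, by simp [smul_inv_smul₀ hl.ne']⟩
      rw [b.coord_eq_linear_add, map_smul, smul_eq_mul]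
      have := mul_nonneg (inv_nonneg.2 hl.le) (h i)
      rwa [mul_add, inv_mul_cancel_left₀ hl.ne'] at this

end AffineBasis

/-- The scale of a finite set relative to a simplex, in terms of the linear parts of the
barycentric coordinates. -/
theorem lScale_convexHull_range {ι : Type*} [Fintype ι] (b : AffineBasis ι ℝ (Fin 2 → ℝ))
    {A : Set (Fin 2 → ℝ)} (hA : A.Finite) (hAne : A.Nonempty) :
    lScale (convexHull ℝ (Set.range b)) A = -∑ i, sInf ((b.coord i).linear '' A) := by
  have hle (i : ι) {a : Fin 2 → ℝ} (ha : a ∈ A) :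
      sInf ((b.coord i).linear '' A) ≤ (b.coord i).linear a :=
    csInf_le (hA.image _).bddBelow (Set.mem_image_of_mem _ ha)
  have hl : 0 ≤ -∑ i, sInf ((b.coord i).linear '' A) := by
    obtain ⟨a, ha⟩ := hAne
    rw [neg_nonneg, ← b.sum_coord_linear_eq_zero a]
    exact Finset.sum_le_sum fun i _ => hle i ha
  refine IsLeast.csInf_eq ⟨⟨hl, ?_⟩, ?_⟩
  · obtain ⟨v, hv⟩ := b.exists_coord_linear_eq
      (fun i => sInf ((b.coord i).linear '' A) +
        (-∑ j, sInf ((b.coord j).linear '' A)) * b.coord i 0)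
      (by rw [Finset.sum_add_distrib, ← Finset.mul_sum, b.sum_coord_apply_eq_one]; ring)
    refine ⟨v, fun a ha => (b.mem_homothetic_convexHull_iff hl v a).2 fun i => ?_⟩
    rw [map_sub, hv]
    linarith [hle i ha]
  · rintro l ⟨hl, v, hv⟩
    have h (i : ι) : (b.coord i).linear v - l * b.coord i 0 ≤ sInf ((b.coord i).linear '' A) := by
      refine le_csInf (hAne.image _) ?_
      rintro _ ⟨a, ha, rfl⟩
      have := (b.mem_homothetic_convexHull_iff hl v a).1 (hv ha) i
      rw [map_sub] at this
      linarith
    have := Finset.sum_le_sum fun i (_ : i ∈ Finset.univ) => h i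
    rw [Finset.sum_sub_distrib, ← Finset.mul_sum, b.sum_coord_apply_eq_one,
      b.sum_coord_linear_eq_zero] at this
    linarith

/-- For a compact triangle `P ⊂ ℝ²` and nonempty finite sets `A, B ⊂ ℝ²`,
`l_{P,A+B} = l_{P,A} + l_{P,B}`. -/
theorem lScale_add (p q r : Fin 2 → ℝ) (hpqr : AffineIndependent ℝ ![p, q, r])
    (P : Set (Fin 2 → ℝ)) (hP : P = convexHull ℝ {p, q, r})
    (A B : Set (Fin 2 → ℝ)) (hA : A.Finite) (hB : B.Finite)
    (hAne : A.Nonempty) (hBne : B.Nonempty) :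
    lScale P (A + B) = lScale P A + lScale P B := by
  let b : AffineBasis (Fin 3) ℝ (Fin 2 → ℝ) :=
    ⟨![p, q, r], hpqr, hpqr.affineSpan_eq_top_iff_card_eq_finrank_add_one.2 (by simp)⟩
  have hb : P = convexHull ℝ (Set.range b) := by
    rw [hP]
    congr 1
    change _ = Set.range ![p, q, r]
    ext x
    simp only [Matrix.range_cons, Matrix.range_empty, Set.mem_union, Set.mem_insert_iff,
      Set.mem_singleton_iff, Set.mem_empty_iff_false, or_false]
  rw [hb, lScale_convexHull_range b (hA.add hB) (hAne.add hBne),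
    lScale_convexHull_range b hA hAne, lScale_convexHull_range b hB hBne, ← neg_add,
    ← Finset.sum_add_distrib]
  congr 1
  refine Finset.sum_congr rfl fun i _ => ?_
  rw [Set.image_add, csInf_add (hAne.image _) (hA.image _).bddBelow (hBne.image _)
    (hB.image _).bddBelow]
end
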